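/- arXiv:math/0003062 — 2 statements merged into one kernel-verified Lean document; each statement's English description precedes it below -/
import Mathlib

section
/- Let K be a number field, S a finite set of maximal ideals of O_K, and R = O_{K,S}. Let Q(x,y) = αx² + βxy + γy² with α, β, γ ∈ R, and suppose the discriminant Δ = β² − 4αγ is not a square in K (so Q is irreducible over K). Assume at least one of the following holds: (i) K has a complex place; (ii) K has a real embedding σ with σ(Δ) > 0; (iii) there is a maximal ideal 𝔭 ∈ S such that Δ is a square in the 𝔭-adic completion K_𝔭. Suppose there exist a, b ∈ R with aR + bR = R and Q(a,b) ∈ R^×. Then the set of points (a' : b') ∈ P¹(K) admitting representatives a', b' ∈ R with a'R + b'R = R and Q(a',b') ∈ R^× is infinite, hence Zariski dense in P¹. -/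
open IsDedekindDomain NumberField

namespace PLB
set_option linter.unusedSectionVars false
set_option linter.style.haveILetI false
variable {K : Type} [Field K] [NumberField K]

theorem isIntegral_star {d : K} {y : QuadraticAlgebra K d 0} (h : IsIntegral ℤ y) :
    IsIntegral ℤ (star y) := by
  have := h.map (starRingEnd (QuadraticAlgebra K d 0)).toIntAlgHom
  exact this

theorem isIntegral_norm {d : K} {y : QuadraticAlgebra K d 0} (h : IsIntegral ℤ y) :
    IsIntegral ℤ (QuadraticAlgebra.norm y) := by
  have h2 := h.mul (isIntegral_star h)
  rw [← QuadraticAlgebra.algebraMap_norm_eq_mul_star] at h2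
  exact (isIntegral_algebraMap_iff QuadraticAlgebra.algebraMap_injective).1 h2

theorem isIntegral_two_re {d : K} {y : QuadraticAlgebra K d 0} (h : IsIntegral ℤ y) :
    IsIntegral ℤ (2 * y.re) := by
  have h2 := h.add (isIntegral_star h)
  rw [← QuadraticAlgebra.algebraMap_trace_eq_add_star] at h2
  have := (isIntegral_algebraMap_iff QuadraticAlgebra.algebraMap_injective).1 h2
  simpa [QuadraticAlgebra.trace_def] using this

theorem isIntegral_of_sq {d : K} {y : QuadraticAlgebra K d 0}
    (h1 : IsIntegral ℤ (2 * y.re)) (h2 : IsIntegral ℤ (QuadraticAlgebra.norm y)) :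
    IsIntegral ℤ y := by
  have hi : IsIntegral (𝓞 K) y := by
    obtain ⟨t, ht⟩ : ∃ t : 𝓞 K, (t : K) = 2 * y.re := ⟨⟨_, h1⟩, rfl⟩
    obtain ⟨n, hn⟩ : ∃ t : 𝓞 K, (t : K) = QuadraticAlgebra.norm y := ⟨⟨_, h2⟩, rfl⟩
    refine ⟨Polynomial.X ^ 2 - Polynomial.C t * Polynomial.X + Polynomial.C n, ?_, ?_⟩
    · monicity!
    · have e1 : algebraMap (𝓞 K) (QuadraticAlgebra K d 0) t = algebraMap K _ (2 * y.re) := by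
        rw [← ht]; rfl
      have e2 : algebraMap (𝓞 K) (QuadraticAlgebra K d 0) n =
          algebraMap K _ (QuadraticAlgebra.norm y) := by
        rw [← hn]; rfl
      simp only [Polynomial.eval₂_add, Polynomial.eval₂_sub, Polynomial.eval₂_pow,
        Polynomial.eval₂_X, Polynomial.eval₂_mul, Polynomial.eval₂_C]
      rw [e1, e2]
      ext
      · simp [QuadraticAlgebra.norm_def, pow_two]; ring
      · simp [QuadraticAlgebra.norm_def, pow_two]; ring
  refine @isIntegral_trans ℤ (𝓞 K) (QuadraticAlgebra K d 0) _ _ _ _ _ _ ?_ _ y hi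
  exact IsScalarTower.of_algebraMap_eq' (RingHom.ext_int _ _)

/-- common denominators -/
theorem exists_denom (d : K) (hd : d ≠ 0) :
    ∃ N : 𝓞 K, N ≠ 0 ∧ ∀ y : QuadraticAlgebra K d 0, IsIntegral ℤ y →
      IsIntegral ℤ ((N : K) * y.re) ∧ IsIntegral ℤ ((N : K) * y.im) := by
  obtain ⟨⟨n, m⟩, hnm⟩ := IsLocalization.surj (nonZeroDivisors (𝓞 K)) d
  have hm : (m : 𝓞 K) ≠ 0 := nonZeroDivisors.ne_zero m.2
  have hn : n ≠ 0 := by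
    rintro rfl
    simp at hnm
    tauto
  have hnm' : d * ((m : 𝓞 K) : K) = (n : K) := hnm
  have e : ((2 * n : 𝓞 K) : K) = 2 * (n : K) := by
    simp only [map_mul, map_ofNat]
  refine ⟨2 * n, mul_ne_zero two_ne_zero hn, fun y hy => ⟨?_, ?_⟩⟩
  · have := (isIntegral_two_re hy).mul n.isIntegral_coe
    have e' : ((2 * n : 𝓞 K) : K) * y.re = 2 * y.re * (n : K) := by rw [e]; ring
    rw [e']; exact this
  · have hδ : IsIntegral ℤ (⟨0, ((m : 𝓞 K) : K)⟩ : QuadraticAlgebra K d 0) := by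
      apply isIntegral_of_sq
      · simp [isIntegral_zero]
      · have : IsIntegral ℤ (-((n : K) * ((m : 𝓞 K) : K))) :=
          (n.isIntegral_coe.mul (m : 𝓞 K).isIntegral_coe).neg
        convert this using 1
        rw [QuadraticAlgebra.norm_def, ← hnm']; ring
    have := isIntegral_two_re (hy.mul hδ)
    convert this using 1
    rw [QuadraticAlgebra.re_mul]
    simp only [e]; rw [← hnm']; simp; ring

theorem val_le_one_of_isIntegral {x : K} (h : IsIntegral ℤ x) (v : HeightOneSpectrum (𝓞 K)) :
    v.valuation K x ≤ 1 :=
  v.valuation_le_one (⟨x, h⟩ : 𝓞 K)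

theorem fact_of {d : K} (hd : ¬ ∃ s : K, s ^ 2 = d) : Fact (∀ r : K, r ^ 2 ≠ d + 0 * r) :=
  ⟨fun r hr => hd ⟨r, by simpa using hr⟩⟩

theorem numberField (d : K) [Fact (∀ r : K, r ^ 2 ≠ d + 0 * r)] :
    NumberField (QuadraticAlgebra K d 0) where
  to_charZero := inferInstance
  to_finiteDimensional := by
    have := Module.Finite.trans (R := ℚ) K (QuadraticAlgebra K d 0)
    convert this

theorem exists_pow (S : Set (HeightOneSpectrum (𝓞 K))) (d : K)
    [Fact (∀ r : K, r ^ 2 ≠ d + 0 * r)] (hd : d ≠ 0)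
    (ε τ : QuadraticAlgebra K d 0) (ϖ : K) (hε : IsIntegral ℤ ε) (hτ : IsIntegral ℤ τ)
    (h : ε * τ = algebraMap K _ ϖ) (hϖ : ∀ v ∉ S, v.valuation K ϖ = 1) :
    ∃ k > 0, (ε ^ k).re ∈ S.integer K ∧ (ε ^ k).im ∈ S.integer K := by
  haveI := numberField d
  obtain ⟨N, hN, hNy⟩ := exists_denom d hd
  let e : 𝓞 (QuadraticAlgebra K d 0) := ⟨ε, hε⟩
  let NL : 𝓞 (QuadraticAlgebra K d 0) := ⟨algebraMap K (QuadraticAlgebra K d 0) (N : K), N.isIntegral_coe.algebraMap⟩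
  have hNL : NL ≠ 0 := by
    intro h0
    have : algebraMap K (QuadraticAlgebra K d 0) (N : K) = 0 := congrArg Subtype.val h0
    simp at this
    exact hN (by exact_mod_cast this)
  have hI : Ideal.span {NL} ≠ ⊥ := by simpa using hNL
  haveI : Finite (𝓞 (QuadraticAlgebra K d 0) ⧸ Ideal.span {NL}) := Ideal.finiteQuotientOfFreeOfNeBot _ hI
  obtain ⟨m, n, hmn, hE⟩ : ∃ m n : ℕ, m < n ∧
      Ideal.Quotient.mk (Ideal.span {NL}) (e ^ m) = Ideal.Quotient.mk (Ideal.span {NL}) (e ^ n) := by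
    obtain ⟨m, n, hne, h⟩ := Finite.exists_ne_map_eq_of_infinite
      (fun n : ℕ => Ideal.Quotient.mk (Ideal.span {NL}) (e ^ n))
    rcases lt_or_gt_of_ne hne with h1 | h1
    · exact ⟨m, n, h1, h⟩
    · exact ⟨n, m, h1, h.symm⟩
  rw [eq_comm, Ideal.Quotient.mk_eq_mk_iff_sub_mem, Ideal.mem_span_singleton'] at hE
  obtain ⟨y, hy⟩ := hE
  have hy' : (y : QuadraticAlgebra K d 0) * algebraMap K (QuadraticAlgebra K d 0) (N : K) = ε ^ n - ε ^ m := congrArg Subtype.val hy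
  obtain ⟨k, rfl⟩ := Nat.exists_eq_add_of_lt hmn
  have hz : IsIntegral ℤ ((y : QuadraticAlgebra K d 0) * τ ^ m) := y.isIntegral_coe.mul (hτ.pow m)
  obtain ⟨h1, h2⟩ := hNy _ hz
  have key : algebraMap K (QuadraticAlgebra K d 0) (ϖ ^ m) * (ε ^ (k + 1) - 1) = algebraMap K (QuadraticAlgebra K d 0) (N : K) * (y * τ ^ m) := by
    rw [map_pow, ← h, mul_pow]
    calc _ = (ε ^ (m + k + 1) - ε ^ m) * τ ^ m := by ring
      _ = _ := by rw [← hy']; ring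
  have k1 := congrArg QuadraticAlgebra.re key
  have k2 := congrArg QuadraticAlgebra.im key
  rw [QuadraticAlgebra.re_mul, QuadraticAlgebra.re_mul] at k1
  rw [QuadraticAlgebra.im_mul, QuadraticAlgebra.im_mul] at k2
  simp only [QuadraticAlgebra.algebraMap_re, QuadraticAlgebra.algebraMap_im, QuadraticAlgebra.re_sub,
    QuadraticAlgebra.im_sub, QuadraticAlgebra.re_one, QuadraticAlgebra.im_one, mul_zero, zero_mul,
    add_zero, sub_zero] at k1 k2
  refine ⟨k + 1, Nat.succ_pos _, ?_, ?_⟩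
  · have : (ε ^ (k + 1)).re - 1 ∈ S.integer K := by
      intro v hv
      have := val_le_one_of_isIntegral h1 v
      rwa [← k1, map_mul, map_pow, hϖ v hv, one_pow, one_mul] at this
    have := add_mem this (one_mem _)
    simpa using this
  · intro v hv
    have := val_le_one_of_isIntegral h2 v
    rwa [← k2, map_mul, map_pow, hϖ v hv, one_pow, one_mul] at this

theorem val_norm (S : Set (HeightOneSpectrum (𝓞 K))) (d : K)
    (ε τ : QuadraticAlgebra K d 0) (ϖ : K) (hε : IsIntegral ℤ ε) (hτ : IsIntegral ℤ τ)
    (h : ε * τ = algebraMap K _ ϖ) (hϖ : ∀ v ∉ S, v.valuation K ϖ = 1) :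
    ∀ v ∉ S, v.valuation K (QuadraticAlgebra.norm ε) = 1 := by
  intro v hv
  have h1 := val_le_one_of_isIntegral (isIntegral_norm hε) v
  have h2 := val_le_one_of_isIntegral (isIntegral_norm hτ) v
  have h3 := congrArg (fun z => v.valuation K (QuadraticAlgebra.norm z)) h
  simp only [map_mul, QuadraticAlgebra.norm_algebraMap, map_pow, hϖ v hv, one_pow] at h3
  exact eq_one_of_one_le_mul_left h1 h2 h3.ge

theorem isUnit_of_val (S : Set (HeightOneSpectrum (𝓞 K))) (x : S.integer K)
    (hx : ∀ v ∉ S, v.valuation K (x : K) = 1) (h0 : (x : K) ≠ 0) : IsUnit x := by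
  refine IsUnit.of_mul_eq_one ⟨(x : K)⁻¹, fun v hv => ?_⟩ (Subtype.ext (by simp [h0]))
  rw [map_inv₀, hx v hv, inv_one]

theorem span_pair_eq_top {R : Type*} [CommRing R] {a b a' b' u p q r s : R} (hu : IsUnit u)
    (h : Ideal.span {a, b} = ⊤) (ha : u * a = p * a' + q * b') (hb : u * b = r * a' + s * b') :
    Ideal.span {a', b'} = ⊤ := by
  rw [eq_top_iff, ← h, Ideal.span_le]
  rintro z (rfl | rfl)
  · rw [SetLike.mem_coe, ← Ideal.unit_mul_mem_iff_mem _ hu, ha]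
    exact Ideal.mem_span_pair.2 ⟨p, q, rfl⟩
  · rw [SetLike.mem_coe, ← Ideal.unit_mul_mem_iff_mem _ hu, hb]
    exact Ideal.mem_span_pair.2 ⟨r, s, rfl⟩

theorem infinite_of_exists
    (S : Set (HeightOneSpectrum (𝓞 K)))
    (α β γ Δ : (S.integer K))
    (hΔdef : Δ = β ^ 2 - 4 * α * γ)
    (hΔ : ¬ ∃ s : K, s ^ 2 = (Δ : K))
    (hex : ∃ (ε τ : QuadraticAlgebra K (Δ : K) 0) (ϖ : K), IsIntegral ℤ ε ∧ IsIntegral ℤ τ ∧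
      ε * τ = algebraMap K _ ϖ ∧ (∀ v ∉ S, v.valuation K ϖ = 1) ∧
      ∀ n > 0, (ε ^ n).im ≠ 0)
    (hpt : ∃ a b : (S.integer K),
      Ideal.span {a, b} = ⊤ ∧ IsUnit (α * a ^ 2 + β * a * b + γ * b ^ 2)) :
    { x : Projectivization K (Fin 2 → K) |
      ∃ a b : (S.integer K),
        Ideal.span {a, b} = ⊤ ∧ IsUnit (α * a ^ 2 + β * a * b + γ * b ^ 2) ∧
        ∃ h : ![(a : K), (b : K)] ≠ 0,
          x = Projectivization.mk K ![(a : K), (b : K)] h }.Infinite := by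
  haveI := fact_of hΔ
  have hΔ0 : (Δ : K) ≠ 0 := fun h => hΔ ⟨0, by simp [h]⟩
  obtain ⟨ε, τ, ϖ, hε, hτ, hετ, hϖ, him⟩ := hex
  obtain ⟨a, b, hab, hQ⟩ := hpt
  obtain ⟨k, hk, hre, him'⟩ := exists_pow S (Δ : K) hΔ0 ε τ ϖ hε hτ hετ hϖ
  have hε0 : ε ≠ 0 := by
    rintro rfl
    exact him 1 one_pos (by simp)
  have hNε := val_norm S (Δ : K) ε τ ϖ hε hτ hετ hϖ
  -- all powers of `ε ^ k` have coordinates in the ring of `S`-integers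
  have hmem : ∀ j : ℕ, ∃ t s : S.integer K, (t : K) = (ε ^ (k * j)).re ∧
      (s : K) = (ε ^ (k * j)).im := by
    intro j
    induction j with
    | zero => exact ⟨1, 0, by simp [QuadraticAlgebra.re_one], by simp [QuadraticAlgebra.im_one]⟩
    | succ j ih =>
      obtain ⟨t, s, ht, hs⟩ := ih
      refine ⟨t * ⟨_, hre⟩ + Δ * s * ⟨_, him'⟩, t * ⟨_, him'⟩ + s * ⟨_, hre⟩, ?_, ?_⟩
      · rw [mul_add, mul_one, pow_add, QuadraticAlgebra.re_mul, ← ht, ← hs]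
        push_cast; ring
      · rw [mul_add, mul_one, pow_add, QuadraticAlgebra.im_mul, ← ht, ← hs]
        push_cast; ring
  choose t s ht hs using hmem
  have hu : ∀ j, IsUnit (t j ^ 2 - Δ * s j ^ 2) := by
    intro j
    have e : ((t j ^ 2 - Δ * s j ^ 2 : S.integer K) : K) =
        QuadraticAlgebra.norm (ε ^ (k * j)) := by
      rw [QuadraticAlgebra.norm_def, ← ht, ← hs]; push_cast; ring
    apply isUnit_of_val
    · intro v hv
      rw [e, map_pow, map_pow, hNε v hv, one_pow]
    · rw [e, Ne, QuadraticAlgebra.norm_eq_zero_iff_eq_zero]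
      exact pow_ne_zero _ hε0
  let A : ℕ → S.integer K := fun j => (t j - β * s j) * a - 2 * γ * s j * b
  let B : ℕ → S.integer K := fun j => 2 * α * s j * a + (t j + β * s j) * b
  have hAa : ∀ j, (t j ^ 2 - Δ * s j ^ 2) * a = (t j + β * s j) * A j + (2 * γ * s j) * B j := by
    intro j; simp only [A, B, hΔdef]; ring
  have hBb : ∀ j, (t j ^ 2 - Δ * s j ^ 2) * b = (-(2 * α * s j)) * A j + (t j - β * s j) * B j := by
    intro j; simp only [A, B, hΔdef]; ring
  have hspan : ∀ j, Ideal.span {A j, B j} = ⊤ := fun j => span_pair_eq_top (hu j) hab (hAa j) (hBb j)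
  have hQj : ∀ j, IsUnit (α * A j ^ 2 + β * A j * B j + γ * B j ^ 2) := by
    intro j
    have : α * A j ^ 2 + β * A j * B j + γ * B j ^ 2 =
      (t j ^ 2 - Δ * s j ^ 2) * (α * a ^ 2 + β * a * b + γ * b ^ 2) := by
      simp only [A, B, hΔdef]; ring
    rw [this]; exact (hu j).mul hQ
  have hne : ∀ x y : S.integer K, IsUnit (α * x ^ 2 + β * x * y + γ * y ^ 2) →
      ![(x : K), (y : K)] ≠ 0 := by
    intro x y h h0
    have hx : x = 0 := by simpa using congrFun h0 0
    have hy : y = 0 := by simpa using congrFun h0 1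
    subst hx hy
    simp at h
  have hinj : Function.Injective
      (fun j => Projectivization.mk K ![(A j : K), (B j : K)] (hne _ _ (hQj j))) := by
    have hlt : ∀ i j, i < j → Projectivization.mk K ![(A j : K), (B j : K)] (hne _ _ (hQj j)) ≠
        Projectivization.mk K ![(A i : K), (B i : K)] (hne _ _ (hQj i)) := by
      intro i j hij h
      rw [Projectivization.mk_eq_mk_iff'] at h
      obtain ⟨c, hc⟩ := h
      have c1 : c * (A i : K) = A j := by simpa using congrFun hc 0
      have c2 : c * (B i : K) = B j := by simpa using congrFun hc 1
      set z : QuadraticAlgebra K (Δ : K) 0 := ε ^ (k * j) - algebraMap K _ c * ε ^ (k * i) with hz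
      have zre : z.re = t j - c * t i := by
        rw [hz, QuadraticAlgebra.re_sub, QuadraticAlgebra.re_mul, ht, ht]; simp
      have zim : z.im = s j - c * s i := by
        rw [hz, QuadraticAlgebra.im_sub, QuadraticAlgebra.im_mul, hs, hs]; simp
      have hΔK : (Δ : K) = (β : K) ^ 2 - 4 * α * γ := by rw [hΔdef]; push_cast; rfl
      simp only [A, B] at c1 c2
      push_cast at c1 c2
      have h2 : ((2 : S.integer K) : K) = 2 := rfl
      rw [h2] at c1 c2
      have e1 : (z.re - β * z.im) * a - 2 * γ * z.im * b = 0 := by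
        rw [zre, zim]; linear_combination -c1
      have e2 : 2 * α * z.im * a + (z.re + β * z.im) * b = 0 := by
        rw [zre, zim]; linear_combination -c2
      have n1 : QuadraticAlgebra.norm z * (a : K) = 0 := by
        rw [QuadraticAlgebra.norm_def]
        linear_combination (z.re + β * z.im) * e1 + 2 * γ * z.im * e2 - z.im ^ 2 * a * hΔK
      have n2 : QuadraticAlgebra.norm z * (b : K) = 0 := by
        rw [QuadraticAlgebra.norm_def]
        linear_combination (z.re - β * z.im) * e2 - 2 * α * z.im * e1 - z.im ^ 2 * b * hΔK
      have hz0 : QuadraticAlgebra.norm z = 0 := by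
        by_contra hnz
        apply hne a b hQ
        have ha0 : (a : K) = 0 := (mul_eq_zero.1 n1).resolve_left hnz
        have hb0 : (b : K) = 0 := (mul_eq_zero.1 n2).resolve_left hnz
        rw [ha0, hb0]; simp
      rw [QuadraticAlgebra.norm_eq_zero_iff_eq_zero, hz, sub_eq_zero] at hz0
      obtain ⟨l, rfl⟩ := Nat.exists_eq_add_of_lt hij
      rw [add_assoc, mul_add, pow_add, mul_comm] at hz0
      have hz1 := mul_right_cancel₀ (pow_ne_zero _ hε0) hz0
      exact him (k * (l + 1)) (by positivity) (by rw [hz1]; simp)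
    intro i j h
    rcases lt_trichotomy i j with h1 | h1 | h1
    · exact absurd h.symm (hlt _ _ h1)
    · exact h1
    · exact absurd h (hlt _ _ h1)
  refine Set.Infinite.mono ?_ (Set.infinite_range_of_injective hinj)
  rintro _ ⟨j, rfl⟩
  exact ⟨A j, B j, hspan j, hQj j, hne _ _ (hQj j), rfl⟩


theorem exists_lift {A : Type*} [CommRing A] (d : K) (φ : K →+* A) (u : A) (hu : u * u = φ d) :
    ∃ ψ : QuadraticAlgebra K d 0 →+* A, ∀ z, ψ z = φ z.re + φ z.im * u := by
  letI := φ.toAlgebra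
  refine ⟨(QuadraticAlgebra.lift (A := A) ⟨u, by
    rw [hu, zero_smul, add_zero, Algebra.smul_def, mul_one]; rfl⟩ :
      QuadraticAlgebra K d 0 →ₐ[K] A).toRingHom, fun z => ?_⟩
  simp [Algebra.smul_def]
  rfl

theorem im_ne_of_lift {A B : Type*} [CommRing A] {d : K} {φ : K →+* A} {u₁ u₂ : A}
    {ψ₁ ψ₂ : QuadraticAlgebra K d 0 →+* A} (h₁ : ∀ z, ψ₁ z = φ z.re + φ z.im * u₁)
    (h₂ : ∀ z, ψ₂ z = φ z.re + φ z.im * u₂) (f : A → B) {z : QuadraticAlgebra K d 0}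
    (hz : f (ψ₁ z) ≠ f (ψ₂ z)) : z.im ≠ 0 := by
  intro h
  apply hz
  rw [h₁, h₂, h]; simp

theorem exists_of_complex (S : Set (HeightOneSpectrum (𝓞 K))) (d : K)
    (hd : ¬ ∃ s : K, s ^ 2 = d) (φ : K →+* ℂ)
    (hφ : ¬ ComplexEmbedding.IsReal φ ∨ ∃ x : ℝ, 0 < x ∧ φ d = x) :
    ∃ (ε τ : QuadraticAlgebra K d 0) (ϖ : K), IsIntegral ℤ ε ∧ IsIntegral ℤ τ ∧
      ε * τ = algebraMap K _ ϖ ∧ (∀ v ∉ S, v.valuation K ϖ = 1) ∧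
      ∀ n > 0, (ε ^ n).im ≠ 0 := by
  haveI := fact_of hd
  haveI := numberField d
  have hd0 : d ≠ 0 := fun h => hd ⟨0, by simp [h]⟩
  obtain ⟨u, hu, hu'⟩ : ∃ u : ℂ, u * u = φ d ∧
      (¬ ComplexEmbedding.IsReal φ ∨ starRingEnd ℂ u = u) := by
    rcases hφ with h | ⟨x, hx, hxd⟩
    · obtain ⟨u, hu⟩ := IsAlgClosed.exists_pow_nat_eq (φ d) (n := 2) (by norm_num)
      exact ⟨u, by rw [← hu]; ring, Or.inl h⟩
    · refine ⟨(Real.sqrt x : ℝ), ?_, Or.inr (Complex.conj_ofReal _)⟩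
      rw [hxd, ← Complex.ofReal_mul, Real.mul_self_sqrt hx.le]
  have hu0 : u ≠ 0 := by
    rintro rfl
    rw [mul_zero, eq_comm, map_eq_zero] at hu
    exact hd0 hu
  obtain ⟨ψ₁, h₁⟩ := exists_lift d φ u hu
  obtain ⟨ψ₂, h₂⟩ := exists_lift d φ (-u) (by rw [neg_mul_neg, hu])
  have hne : InfinitePlace.mk ψ₂ ≠ InfinitePlace.mk ψ₁ := by
    intro h
    rw [InfinitePlace.mk_eq_iff] at h
    have hω : ψ₂ ⟨0, 1⟩ = -u ∧ ψ₁ ⟨0, 1⟩ = u := by rw [h₁, h₂]; simp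
    have hneg : -u ≠ u := fun h => hu0 (by
      have : (2 : ℂ) * u = 0 := by linear_combination -h
      simpa using this)
    rcases h with h | h
    · apply hneg
      rw [← hω.1, h, hω.2]
    · rcases hu' with h' | h'
      · apply h'
        rw [ComplexEmbedding.isReal_iff]
        ext x
        have := congrArg (fun f => f (algebraMap K (QuadraticAlgebra K d 0) x)) h
        simpa [ComplexEmbedding.conjugate_coe_eq, h₁, h₂] using this
      · apply hneg
        have := congrArg (fun f => f (⟨0, 1⟩ : QuadraticAlgebra K d 0)) h
        simpa [ComplexEmbedding.conjugate_coe_eq, h₁, h₂, h'] using this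
  obtain ⟨e, he⟩ := Units.dirichletUnitTheorem.exists_unit (QuadraticAlgebra K d 0)
    (InfinitePlace.mk ψ₁)
  have hsum := Units.sum_mult_mul_log e
  have h2lt := he _ hne
  have hlt1 : 0 < Real.log (InfinitePlace.mk ψ₁ (e : QuadraticAlgebra K d 0)) := by
    by_contra hle
    push Not at hle
    have : ∑ w : InfinitePlace (QuadraticAlgebra K d 0),
        w.mult * Real.log (w (e : QuadraticAlgebra K d 0)) < 0 := by
      apply Finset.sum_neg'
      · intro w _
        refine mul_nonpos_of_nonneg_of_nonpos (Nat.cast_nonneg _) ?_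
        by_cases hw : w = InfinitePlace.mk ψ₁
        · rw [hw]; exact hle
        · exact (he w hw).le
      · exact ⟨InfinitePlace.mk ψ₂, Finset.mem_univ _,
          mul_neg_of_pos_of_neg (by exact_mod_cast InfinitePlace.mult_pos) h2lt⟩
    exact absurd hsum this.ne
  refine ⟨((e : 𝓞 (QuadraticAlgebra K d 0)) : QuadraticAlgebra K d 0),
    ((↑(e⁻¹) : 𝓞 (QuadraticAlgebra K d 0)) : QuadraticAlgebra K d 0), 1,
    RingOfIntegers.isIntegral_coe _, RingOfIntegers.isIntegral_coe _, ?_, by simp, ?_⟩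
  · rw [map_one]
    exact congrArg Subtype.val e.mul_inv
  · intro n hn
    apply im_ne_of_lift h₁ h₂ (fun z => Real.log ‖z‖)
    have e1 : ∀ ψ : QuadraticAlgebra K d 0 →+* ℂ, ∀ z, InfinitePlace.mk ψ z = ‖ψ z‖ :=
      fun _ _ => rfl
    rw [e1] at h2lt hlt1
    simp only [map_pow, norm_pow, Real.log_pow]
    have : (0 : ℝ) < n := by exact_mod_cast hn
    exact ((mul_neg_of_pos_of_neg this h2lt).trans (mul_pos this hlt1)).ne'


theorem exists_pow_principal {O : Type*} [CommRing O] [IsDedekindDomain O] [Finite (ClassGroup O)]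
    (I : Ideal O) (hI : I ≠ ⊥) : ∃ h > 0, ∃ g : O, I ^ h = Ideal.span {g} := by
  have hI' : I ∈ nonZeroDivisors (Ideal O) := mem_nonZeroDivisors_of_ne_zero hI
  refine ⟨Nat.card (ClassGroup O), Nat.card_pos, ?_⟩
  have h1 : ClassGroup.mk0 (⟨I, hI'⟩ ^ Nat.card (ClassGroup O)) = 1 := by
    rw [map_pow, pow_card_eq_one']
  have h2 := (ClassGroup.mk0_eq_one_iff (I := I ^ Nat.card (ClassGroup O)) (pow_mem hI' _)).1 h1
  exact h2.principal

theorem exists_val_ideal {O Γ : Type*} [CommRing O] [LinearOrderedCommGroupWithZero Γ]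
    (val : Valuation O Γ) (h : ∀ z, val z ≤ 1) : ∃ P : Ideal O, ∀ z, z ∈ P ↔ val z < 1 := by
  refine ⟨{ carrier := {z | val z < 1}, zero_mem' := by simp, add_mem' := ?_, smul_mem' := ?_ },
    fun z => Iff.rfl⟩
  · intro a b ha hb
    exact val.map_add_lt ha hb
  · intro c z hz
    change val (c * z) < 1
    rw [map_mul]
    exact (mul_le_of_le_one_left' (h c)).trans_lt hz

theorem val_le_one_of_int {C Γ : Type*} [Field C] [LinearOrderedCommGroupWithZero Γ]
    (w : Valuation C Γ) {z : C} (hz : IsIntegral ℤ z) : w z ≤ 1 := by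
  have h1 : IsIntegral w.integer z := by
    refine hz.tower_top
  exact Valuation.Integers.mem_of_integral (Valuation.integer.integers w) h1

theorem val_le_one_of_hom {L C Γ : Type*} [Field L] [NumberField L] [Field C]
    [LinearOrderedCommGroupWithZero Γ] (w : Valuation C Γ) (ψ : L →+* C) (z : 𝓞 L) :
    w (ψ z) ≤ 1 :=
  val_le_one_of_int w (z.isIntegral_coe.map ψ.toIntAlgHom)

theorem isOpen_aux {C Γ : Type*} [Field C] [LinearOrderedCommGroupWithZero Γ] [Valued C Γ]
    (x y : C) : IsOpen {z : C | (Valued.v : Valuation C Γ) (z - x) < Valued.v y} := by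
  have h := (Valued.isOpen_ball (R := C) (Γ₀ := Γ) ((Valued.v : Valuation C Γ).restrict y)).preimage
    (continuous_id.sub (continuous_const (y := x)))
  convert h using 1
  ext z
  simp [Valuation.restrict_lt_iff]

theorem exists_of_padic (S : Set (HeightOneSpectrum (𝓞 K))) (d : K)
    (hd : ¬ ∃ s : K, s ^ 2 = d) (v : HeightOneSpectrum (𝓞 K)) (hv : v ∈ S)
    (x : v.adicCompletion K) (hx : x ^ 2 = algebraMap K (v.adicCompletion K) d) :
    ∃ (ε τ : QuadraticAlgebra K d 0) (ϖ : K), IsIntegral ℤ ε ∧ IsIntegral ℤ τ ∧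
      ε * τ = algebraMap K _ ϖ ∧ (∀ v ∉ S, v.valuation K ϖ = 1) ∧
      ∀ n > 0, (ε ^ n).im ≠ 0 := by
  haveI := fact_of hd
  haveI := numberField d
  have hd0 : d ≠ 0 := fun h => hd ⟨0, by simp [h]⟩
  set φ := algebraMap K (v.adicCompletion K) with hφdef
  obtain ⟨w, hw⟩ : ∃ w : Valuation (v.adicCompletion K) (WithZero (Multiplicative ℤ)),
      w = Valued.v := ⟨_, rfl⟩
  have hφ : ∀ k, w (φ k) = v.valuation K k := fun k => by
    rw [hw]; exact HeightOneSpectrum.valuedAdicCompletion_eq_valuation' v k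
  have hx0 : x ≠ 0 := by
    rintro rfl
    rw [zero_pow two_ne_zero, eq_comm, map_eq_zero] at hx
    exact hd0 hx
  have h20 : (2 : v.adicCompletion K) ≠ 0 := by
    have := (map_ne_zero φ).2 (two_ne_zero (α := K))
    rwa [map_ofNat] at this
  have hw2 : w 2 ≤ 1 := by
    have h : v.valuation K (algebraMap (𝓞 K) K 2) ≤ 1 := v.valuation_le_one (K := K) (2 : 𝓞 K)
    rw [map_ofNat (algebraMap (𝓞 K) K) 2, ← hφ, map_ofNat] at h
    exact h
  have hw2x : w (2 * x) ≠ 0 := (map_ne_zero w).2 (mul_ne_zero h20 hx0)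
  obtain ⟨x₀, hx₀⟩ : ∃ x₀ : K, w (φ x₀ - x) < w (2 * x) := by
    have hopen : IsOpen {y : v.adicCompletion K | w (y - x) < w (2 * x)} := by
      rw [hw]; exact isOpen_aux x (2 * x)
    obtain ⟨k, hk⟩ := (HeightOneSpectrum.denseRange_algebraMap (K := K) (v := v)).exists_mem_open hopen
      ⟨x, by simpa using zero_lt_iff.2 hw2x⟩
    exact ⟨k, hk⟩
  have hplus : w (φ x₀ + x) = w (2 * x) := by
    have : φ x₀ + x = 2 * x + (φ x₀ - x) := by ring
    rw [this, Valuation.map_add_eq_of_lt_left _ hx₀]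
  have h2x₀ : w (2 * φ x₀) = w (2 * x) := by
    have : 2 * φ x₀ = 2 * x + 2 * (φ x₀ - x) := by ring
    rw [this, Valuation.map_add_eq_of_lt_left]
    rw [map_mul w 2 (φ x₀ - x)]
    exact (mul_le_of_le_one_left' hw2).trans_lt hx₀
  have hx₀0 : x₀ ≠ 0 := by
    rintro rfl
    rw [map_zero, mul_zero, map_zero] at h2x₀
    exact hw2x h2x₀.symm
  have hφx₀0 : φ x₀ ≠ 0 := (map_ne_zero φ).2 hx₀0
  -- the norm of `(x₀ - δ) / (2 x₀)`
  have hm : v.valuation K ((x₀ ^ 2 - d) / (2 * x₀) ^ 2) ≤ 1 := by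
    rw [← hφ, map_div₀, map_div₀, map_sub, map_pow, map_pow, map_mul, map_ofNat, ← hx, map_pow,
      h2x₀]
    have : φ x₀ ^ 2 - x ^ 2 = (φ x₀ - x) * (φ x₀ + x) := by ring
    rw [this, map_mul w, hplus, pow_two]
    refine div_le_one_of_le₀ ?_ zero_le
    exact mul_le_mul_left hx₀.le _
  obtain ⟨n, c, hnc⟩ := v.exists_primeCompl_mul_eq_of_integer _ hm
  have hc : w (φ ((c : 𝓞 K) : K)) = 1 := by
    rw [hφ]
    exact (HeightOneSpectrum.valuation_eq_one_iff_notMem v).2 c.2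
  obtain ⟨Y, hY⟩ : ∃ Y : QuadraticAlgebra K d 0,
    Y = ⟨((c : 𝓞 K) : K) / 2, -((c : 𝓞 K) : K) / (2 * x₀)⟩ := ⟨_, rfl⟩
  have hYint : IsIntegral ℤ Y := by
    apply isIntegral_of_sq
    · rw [hY]
      have : 2 * (((c : 𝓞 K) : K) / 2) = ((c : 𝓞 K) : K) := by field_simp
      rw [this]; exact (c : 𝓞 K).isIntegral_coe
    · have : QuadraticAlgebra.norm Y = ((c : 𝓞 K) : K) * (n : K) := by
        have hnc' : (x₀ ^ 2 - d) / (2 * x₀) ^ 2 * ((c : 𝓞 K) : K) = (n : K) := hnc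
        rw [← hnc', hY, QuadraticAlgebra.norm_def]
        field_simp
        ring
      rw [this]
      exact (c : 𝓞 K).isIntegral_coe.mul n.isIntegral_coe
  obtain ⟨ψ₁, h₁⟩ := exists_lift d φ x (by rw [← hx, pow_two])
  obtain ⟨ψ₂, h₂⟩ := exists_lift d φ (-x) (by rw [← hx, pow_two, neg_mul_neg])
  have hY1 : w (ψ₁ Y) < 1 := by
    have : ψ₁ Y = φ ((c : 𝓞 K) : K) * (φ x₀ - x) / (2 * φ x₀) := by
      rw [h₁, hY]
      simp only [map_div₀, map_neg, map_mul, map_ofNat]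
      field_simp
      ring
    rw [this, map_div₀, map_mul w, hc, one_mul, h2x₀]
    exact (div_lt_one₀ (zero_lt_iff.2 hw2x)).2 hx₀
  have hY2 : w (ψ₂ Y) = 1 := by
    have : ψ₂ Y = φ ((c : 𝓞 K) : K) * (φ x₀ + x) / (2 * φ x₀) := by
      rw [h₂, hY]
      simp only [map_div₀, map_neg, map_mul, map_ofNat]
      field_simp
    rw [this, map_div₀, map_mul w, hc, one_mul, h2x₀, hplus, div_self hw2x]
  have hle_one : ∀ (ψ : QuadraticAlgebra K d 0 →+* v.adicCompletion K)
      (z : 𝓞 (QuadraticAlgebra K d 0)), w (ψ z) ≤ 1 := fun ψ z =>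
    val_le_one_of_hom w ψ z
  obtain ⟨P, hP⟩ := exists_val_ideal (w.comap (ψ₁.comp
    (algebraMap (𝓞 (QuadraticAlgebra K d 0)) (QuadraticAlgebra K d 0)))) (hle_one ψ₁)
  replace hP : ∀ z : 𝓞 (QuadraticAlgebra K d 0), z ∈ P ↔ w (ψ₁ z) < 1 := hP
  have hψK : ∀ k : K, ψ₁ (algebraMap K _ k) = φ k := fun k => by rw [h₁]; simp
  have hmap : v.asIdeal.map (algebraMap (𝓞 K) (𝓞 (QuadraticAlgebra K d 0))) ≤ P := by
    rw [Ideal.map_le_iff_le_comap]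
    intro r hr
    rw [Ideal.mem_comap, hP]
    have : w (ψ₁ (algebraMap K (QuadraticAlgebra K d 0) (r : K))) < 1 := by
      rw [hψK, hφ]
      exact (v.valuation_lt_one_iff_mem r).2 hr
    exact this
  have hinj : Function.Injective (algebraMap (𝓞 K) (𝓞 (QuadraticAlgebra K d 0))) :=
    FaithfulSMul.algebraMap_injective _ _
  have hP0 : P ≠ ⊥ := by
    intro h
    rw [h, le_bot_iff, Ideal.map_eq_bot_iff_of_injective hinj] at hmap
    exact v.ne_bot hmap
  obtain ⟨a, ha, ϖ, hϖ⟩ := exists_pow_principal v.asIdeal v.ne_bot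
  obtain ⟨b, hb, π, hπ⟩ := exists_pow_principal P hP0
  have hπ1 : w (ψ₁ π) < 1 := by
    rw [← hP]
    exact Ideal.pow_le_self hb.ne' (hπ ▸ Ideal.mem_span_singleton_self π)
  have hπ2 : w (ψ₂ π) = 1 := by
    refine le_antisymm (hle_one ψ₂ π) ?_
    have hYP : (⟨Y, hYint⟩ : 𝓞 (QuadraticAlgebra K d 0)) ∈ P := (hP _).2 hY1
    have hYb : _ ∈ Ideal.span {π} := hπ.le (Ideal.pow_mem_pow hYP b)
    obtain ⟨g, hg⟩ := Ideal.mem_span_singleton'.1 hYb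
    have hg' : (g : QuadraticAlgebra K d 0) * π = Y ^ b := congrArg Subtype.val hg
    have h3 := congrArg (fun z => w (ψ₂ z)) hg'
    simp only [map_mul, map_pow, hY2, one_pow] at h3
    rw [← h3]
    exact mul_le_of_le_one_left' (hle_one ψ₂ g)
  have hdvd : π ^ a ∣ (algebraMap (𝓞 K) (𝓞 (QuadraticAlgebra K d 0)) ϖ) ^ b := by
    rw [← Ideal.mem_span_singleton, ← Ideal.span_singleton_pow, ← hπ, ← pow_mul, mul_comm, pow_mul]
    apply Ideal.pow_mem_pow
    apply Ideal.pow_right_mono hmap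
    rw [← Ideal.map_pow, hϖ]
    exact Ideal.mem_map_of_mem _ (Ideal.mem_span_singleton_self ϖ)
  obtain ⟨τ, hτ⟩ := hdvd
  refine ⟨(π : QuadraticAlgebra K d 0) ^ a, τ, (ϖ : K) ^ b, π.isIntegral_coe.pow a,
    τ.isIntegral_coe, ?_, ?_, ?_⟩
  · rw [map_pow]
    exact (congrArg Subtype.val hτ).symm
  · intro q hq
    have hϖq : ϖ ∉ q.asIdeal := by
      intro hmem
      have h1 : v.asIdeal ^ a ≤ q.asIdeal := by
        rw [hϖ, Ideal.span_singleton_le_iff_mem]; exact hmem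
      have h2 : v.asIdeal ≤ q.asIdeal := Ideal.IsPrime.le_of_pow_le h1
      have h3 : v.asIdeal = q.asIdeal := v.isMaximal.eq_of_le q.isPrime.ne_top h2
      exact hq (by rwa [← HeightOneSpectrum.ext h3])
    rw [map_pow, (HeightOneSpectrum.valuation_eq_one_iff_notMem q).2 hϖq, one_pow]
  · intro n hn
    rw [← pow_mul]
    apply im_ne_of_lift h₁ h₂ w
    rw [map_pow, map_pow, map_pow, map_pow, hπ2, one_pow]
    exact (pow_lt_one₀ zero_le hπ1 (by positivity)).ne

end PLB

/-- **A rational curve with an irreducible rational bisection removed has Zariski dense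
`S`-integral points once it has one and the rank of the corresponding nonsplit torus is
positive** (part (b) of Corollary 6.6 of the paper, after Beukers, in coordinates).

Let `K` be a number field, `S` a finite set of maximal ideals of `𝓞 K` and `R` the ring
of `S`-integers.  Let `Q(x,y) = αx² + βxy + γy²` with `α, β, γ ∈ R` and discriminant
`Δ = β² − 4αγ` not a square in `K`.  Assume that `K` has a complex place, or a real
embedding making `Δ` positive, or that `Δ` is a square in the completion `K_𝔭` for some
`𝔭 ∈ S`.  If there exist `a, b ∈ R` with `aR + bR = R` and `Q(a,b) ∈ Rˣ`, then the set
of points `(a' : b') ∈ ℙ¹(K)` admitting representatives `a', b' ∈ R` with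
`a'R + b'R = R` and `Q(a',b') ∈ Rˣ` is infinite, hence Zariski dense in `ℙ¹`. -/
theorem projective_line_minus_irreducible_bisection_integral_points_dense
    (K : Type) [Field K] [NumberField K]
    (S : Finset (HeightOneSpectrum (𝓞 K)))
    (α β γ Δ : ((S : Set (HeightOneSpectrum (𝓞 K))).integer K))
    (hΔdef : Δ = β ^ 2 - 4 * α * γ)
    -- `Δ` is not a square in `K` (so `Q` is irreducible over `K`)
    (hΔ : ¬ ∃ s : K, s ^ 2 = (Δ : K))
    -- (i) a complex place, or (ii) a real embedding with `σ(Δ) > 0`, or (iii) a prime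
    -- `𝔭 ∈ S` such that `Δ` is a square in the completion `K_𝔭`
    (hplace :
      (∃ v : InfinitePlace K, v.IsComplex) ∨
      (∃ σ : K →+* ℝ, 0 < σ (Δ : K)) ∨
      (∃ v ∈ S, ∃ x : v.adicCompletion K,
        x ^ 2 = algebraMap K (v.adicCompletion K) (Δ : K)))
    (hpt : ∃ a b : ((S : Set (HeightOneSpectrum (𝓞 K))).integer K),
      Ideal.span {a, b} = ⊤ ∧ IsUnit (α * a ^ 2 + β * a * b + γ * b ^ 2)) :
    { x : Projectivization K (Fin 2 → K) |
      ∃ a b : ((S : Set (HeightOneSpectrum (𝓞 K))).integer K),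
        Ideal.span {a, b} = ⊤ ∧ IsUnit (α * a ^ 2 + β * a * b + γ * b ^ 2) ∧
        ∃ h : ![(a : K), (b : K)] ≠ 0,
          x = Projectivization.mk K ![(a : K), (b : K)] h }.Infinite := by
  apply PLB.infinite_of_exists (S : Set (HeightOneSpectrum (𝓞 K))) α β γ Δ hΔdef hΔ ?_ hpt
  rcases hplace with ⟨v, hv⟩ | ⟨σ, hσ⟩ | ⟨v, hv, x, hx⟩
  · exact PLB.exists_of_complex _ _ hΔ v.embedding (Or.inl (InfinitePlace.isComplex_iff.1 hv))
  · exact PLB.exists_of_complex _ _ hΔ (Complex.ofRealHom.comp σ) (Or.inr ⟨σ (Δ : K), hσ, rfl⟩)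
  · exact PLB.exists_of_padic _ _ hΔ v (Finset.mem_coe.2 hv) x hx
end

section
/- Let K be a number field, N ≥ 2, and Z ⊂ P^N a closed subvariety defined over K of dimension at most N − 2. Then there exist a finite extension K' of K, a finite set S of maximal ideals of O_{K'} with R = O_{K',S}, and homogeneous polynomials g₁,…,g_m ∈ R[x₀,…,x_N] generating the homogeneous ideal of Z over K', such that the set of points (a₀ : ⋯ : a_N) ∈ P^N(K') admitting representatives a₀,…,a_N ∈ R with a₀R + ⋯ + a_NR = R and g₁(a)R + ⋯ + g_m(a)R = R is Zariski dense in P^N, i.e., for every nonzero homogeneous polynomial G over K' there is such a point at which G ≠ 0. -/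
open MvPolynomial IsDedekindDomain NumberField

theorem elim_aux {A F : Type*} [CommRing A] [IsDomain A] [Field F] [Algebra A F]
    [IsFractionRing A F] (I : Ideal (Polynomial A))
    (h : I.map (Polynomial.mapRingHom (algebraMap A F)) = ⊤) :
    ∃ d : A, d ≠ 0 ∧ Polynomial.C d ∈ I := by
  let := Polynomial.algebra A F
  have := Polynomial.isLocalization (nonZeroDivisors A) F
  have h2 : ¬ Disjoint (((nonZeroDivisors A).map Polynomial.C : Submonoid (Polynomial A)) : Set (Polynomial A)) (I : Set (Polynomial A)) := by
    rw [← IsLocalization.map_algebraMap_ne_top_iff_disjoint _ (Polynomial F)]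
    simpa using h
  rw [Set.not_disjoint_iff] at h2
  obtain ⟨_, ⟨d, hd, rfl⟩, hI⟩ := h2
  exact ⟨d, nonZeroDivisors.ne_zero hd, hI⟩

theorem lying_aux {A B : Type*} [CommRing A] [CommRing B] [Algebra A B] [Algebra.IsIntegral A B]
    (hinj : Function.Injective (algebraMap A B)) (P : Ideal A) [P.IsPrime] :
    ∃ Q : Ideal B, Q.IsPrime ∧ Q.comap (algebraMap A B) = P := by
  obtain ⟨Q, -, h1, h2⟩ := Ideal.exists_ideal_over_prime_of_isIntegral P (⊥ : Ideal B) (by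
    have : (⊥ : Ideal B).comap (algebraMap A B) = ⊥ := (RingHom.injective_iff_ker_eq_bot _).1 hinj
    rw [this]; exact bot_le)
  exact ⟨Q, h1, h2⟩

theorem dim_aux {A B : Type*} [CommRing A] [CommRing B] (f : A →+* B)
    (hinj : Function.Injective f) (hint : f.IsIntegral) : ringKrullDim A ≤ ringKrullDim B := by
  algebraize [f]
  have : Algebra.IsIntegral A B := ⟨hint⟩
  refine iSup_le fun l => ?_
  obtain ⟨P, hP, hP2⟩ := lying_aux (B := B) hinj (RelSeries.head l).asIdeal
  have : P.LiesOver (RelSeries.head l).asIdeal := ⟨hP2.symm⟩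
  obtain ⟨L, hL, -⟩ := Ideal.exists_ltSeries_of_hasGoingUp (S := B) l P
  rw [← hL]
  exact le_iSup (fun p : LTSeries (PrimeSpectrum B) => (p.length : WithBot ℕ∞)) L

theorem noether_aux {K E : Type*} [Field K] [Field E] [Algebra K E] {n d : ℕ}
    (J : Ideal (MvPolynomial (Fin n) K))
    (hd : ringKrullDim (MvPolynomial (Fin n) K ⧸ J) ≤ (d : ℕ))
    (ψ : MvPolynomial (Fin n) K →ₐ[K] E) (hψ : ∀ f ∈ J, ψ f = 0) :
    ∃ T : Set E, T.encard ≤ d ∧ ∀ p, IsAlgebraic (Algebra.adjoin K T) (ψ p) := by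
  have hJ : J ≠ ⊤ := by
    rintro rfl
    have := hψ 1 trivial
    simp at this
  obtain ⟨s, -, g, hg, hgi⟩ := exists_integral_inj_algHom_of_quotient J hJ
  have hs := (dim_aux g.toRingHom hg hgi).trans hd
  have hs' : s ≤ d := by
    rw [MvPolynomial.ringKrullDim_of_isNoetherianRing, ringKrullDim_eq_zero_of_field] at hs
    simp at hs
    exact_mod_cast hs
  let ψ' : (MvPolynomial (Fin n) K ⧸ J) →ₐ[K] E := Ideal.Quotient.liftₐ J ψ hψ
  let t : Fin s → E := fun i => ψ' (g (X i))
  refine ⟨Set.range t, ?_, fun p => ?_⟩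
  · rw [← Set.image_univ]
    refine (Set.encard_image_le _ _).trans ?_
    simp [Set.encard_univ]
    exact hs'
  · have h1 := hgi (Ideal.Quotient.mk J p)
    obtain ⟨q, hq, hq0⟩ := h1
    have hmem : ∀ x, ψ' (g x) ∈ Algebra.adjoin K (Set.range t) := by
      intro x
      rw [Algebra.adjoin_range_eq_range_aeval]
      refine ⟨x, ?_⟩
      have : aeval t = ψ'.comp g := by ext i; simp [t]
      rw [this]; rfl
    let θ : MvPolynomial (Fin s) K →+* Algebra.adjoin K (Set.range t) :=
      ((ψ'.comp g).codRestrict _ hmem).toRingHom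
    have : IsIntegral (Algebra.adjoin K (Set.range t)) (ψ p) := by
      refine ⟨q.map θ, hq.map _, ?_⟩
      rw [Polynomial.eval₂_map]
      have h3 := congrArg ψ' hq0
      rw [map_zero] at h3
      rw [← h3]
      have := Polynomial.hom_eval₂ q g.toRingHom ψ'.toRingHom (Ideal.Quotient.mk J p)
      exact this.symm
    exact this.isAlgebraic

theorem trdeg_aux {K E : Type*} [Field K] [Field E] [Algebra K E] {n d : ℕ}
    (J : Ideal (MvPolynomial (Fin n) K)) (hdn : d + 2 ≤ n)
    (hd : ringKrullDim (MvPolynomial (Fin n) K ⧸ J) ≤ (d : ℕ))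
    (w : Fin n → E) (hw : AlgebraicIndependent K w) (Q : Fin n → K) (α : E) (hα : α ≠ 0)
    (hJ : ∀ f ∈ J, aeval (fun i => algebraMap K E (Q i) + α * w i) f = 0) : False := by
  obtain ⟨T, hT, halg⟩ := noether_aux J hd (aeval (fun i => algebraMap K E (Q i) + α * w i)) hJ
  have hsub : Set.range w ⊆ (AlgebraicIndependent.matroid K E).closure (insert α T) := by
    rintro _ ⟨i, rfl⟩
    rw [AlgebraicIndependent.matroid_closure_eq]
    have h1 : algebraMap K E (Q i) + α * w i ∈
        (Subalgebra.algebraicClosure (Algebra.adjoin K (insert α T)) E) := by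
      have := halg (X i)
      rw [aeval_X] at this
      exact this.adjoin_of_forall_isAlgebraic (fun x hx => (hx.2 (Set.mem_insert_of_mem _ hx.1)).elim)
    have h2 : α ∈ (Subalgebra.algebraicClosure (Algebra.adjoin K (insert α T)) E) :=
      isAlgebraic_algebraMap (A := E) (⟨α, Algebra.subset_adjoin (Set.mem_insert _ _)⟩ :
        Algebra.adjoin K (insert α T))
    have h3 : algebraMap K E (Q i) ∈ (Subalgebra.algebraicClosure (Algebra.adjoin K (insert α T)) E) :=
      isAlgebraic_algebraMap (A := E) (algebraMap K (Algebra.adjoin K (insert α T)) (Q i))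
    have h4 : α⁻¹ ∈ (Subalgebra.algebraicClosure (Algebra.adjoin K (insert α T)) E) :=
      IsAlgebraic.inv h2
    have h5 : w i = α⁻¹ * ((algebraMap K E (Q i) + α * w i) - algebraMap K E (Q i)) := by
      field_simp; ring
    rw [h5]
    exact mul_mem h4 (sub_mem h1 h3)
  have hind : (AlgebraicIndependent.matroid K E).Indep (Set.range w) :=
    AlgebraicIndependent.matroid_indep_iff.2 (AlgebraicIndependent.coe_range hw)
  have h := hind.encard_le_eRk_of_subset hsub
  rw [Matroid.eRk_closure_eq] at h
  have h2 := (h.trans (Matroid.eRk_le_encard _ _)).trans (Set.encard_insert_le _ _)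
  have h3 : (Set.range w).encard = n := by
    rw [← Set.image_univ, hw.injective.injOn.encard_image]
    simp [Set.encard_univ]
  rw [h3] at h2
  have h4 : (n : ℕ∞) ≤ d + 1 := h2.trans (by gcongr)
  have h5 : n ≤ d + 1 := by exact_mod_cast h4
  omega

theorem generic_aux {K : Type*} [Field K] {n d : ℕ}
    (J : Ideal (MvPolynomial (Fin n) K)) (hdn : d + 2 ≤ n)
    (hd : ringKrullDim (MvPolynomial (Fin n) K ⧸ J) ≤ (d : ℕ))
    (Q : Fin n → K) (hQ : ∃ f ∈ J, eval Q f ≠ 0) :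
    ∃ D : MvPolynomial (Fin n) K, D ≠ 0 ∧ Polynomial.C D ∈
      J.map (aeval (R := K) (fun i => Polynomial.C (C (Q i)) + Polynomial.X * Polynomial.C (X i) :
        Fin n → Polynomial (MvPolynomial (Fin n) K))) := by
  set φ := aeval (R := K) (fun i => Polynomial.C (C (Q i)) + Polynomial.X * Polynomial.C (X i) :
        Fin n → Polynomial (MvPolynomial (Fin n) K)) with hφ
  let A := MvPolynomial (Fin n) K
  let F := FractionRing A
  let E := AlgebraicClosure F
  apply elim_aux (F := F)
  by_contra hne
  set I' := (J.map φ).map (Polynomial.mapRingHom (algebraMap A F)) with hI'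
  obtain ⟨h, hh⟩ := (IsPrincipalIdealRing.principal I').principal
  have hdeg : h.degree ≠ 0 := by
    intro h0
    apply hne
    have := Polynomial.isUnit_iff_degree_eq_zero.2 h0
    change I' = Ideal.span {h} at hh
    rw [hh, Ideal.span_singleton_eq_top]
    exact this
  obtain ⟨α, hα⟩ := IsAlgClosed.exists_aeval_eq_zero E h hdeg
  have hz : ∀ p ∈ I', Polynomial.aeval α p = 0 := by
    intro p hp
    rw [hh] at hp
    obtain ⟨c, rfl⟩ := Ideal.mem_span_singleton.1 hp
    rw [map_mul, hα, zero_mul]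
  let w : Fin n → E := fun i => algebraMap F E (algebraMap A F (X i))
  have hψ : ∀ f : A, aeval (fun i => algebraMap K E (Q i) + α * w i) f =
      Polynomial.aeval α (Polynomial.mapRingHom (algebraMap A F) (φ f)) := by
    intro f
    have : (aeval (fun i => algebraMap K E (Q i) + α * w i) : A →ₐ[K] E).toRingHom =
      ((Polynomial.aeval α : Polynomial F →ₐ[F] E).toRingHom.comp
        (Polynomial.mapRingHom (algebraMap A F))).comp φ.toRingHom := by
      apply MvPolynomial.ringHom_ext
      · intro r
        simp [φ, IsScalarTower.algebraMap_apply K F E, IsScalarTower.algebraMap_apply K A F, A]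
      · intro i
        simp [φ, w, IsScalarTower.algebraMap_apply K F E, IsScalarTower.algebraMap_apply K A F, A]
        exact mul_comm _ _
    exact congrArg (fun g : A →+* E => g f) this
  have hJ0 : ∀ f ∈ J, aeval (fun i => algebraMap K E (Q i) + α * w i) f = 0 := by
    intro f hf
    rw [hψ]
    exact hz _ (Ideal.mem_map_of_mem _ (Ideal.mem_map_of_mem _ hf))
  have hα0 : α ≠ 0 := by
    rintro rfl
    obtain ⟨f, hf, hne⟩ := hQ
    have := hJ0 f hf
    simp only [zero_mul, add_zero] at this
    rw [show (fun i => algebraMap K E (Q i)) = algebraMap K E ∘ Q from rfl, aeval_algebraMap_apply] at this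
    apply hne
    simpa using this
  have hw : AlgebraicIndependent K w := by
    have h1 := MvPolynomial.algebraicIndependent_X (Fin n) K
    have h2 := h1.map' (f := IsScalarTower.toAlgHom K A F) (IsFractionRing.injective A F)
    exact h2.map' (f := IsScalarTower.toAlgHom K F E) (algebraMap F E).injective
  exact trdeg_aux J hdn hd w hw Q α hα0 hJ0

theorem shift_ne_zero {K : Type*} [Field K] {n : ℕ} (Q : Fin n → K)
    (G : MvPolynomial (Fin n) K) (hG : G ≠ 0) :
    aeval (fun i => C (Q i) + X i : Fin n → MvPolynomial (Fin n) K) G ≠ 0 := by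
  intro h
  apply hG
  have h1 : (aeval (fun i => X i - C (Q i) : Fin n → MvPolynomial (Fin n) K)).comp
      (aeval (fun i => C (Q i) + X i : Fin n → MvPolynomial (Fin n) K)) = AlgHom.id K _ := by
    ext i : 1
    simp [MvPolynomial.algHom_C, MvPolynomial.algebraMap_eq]
  have h2 := congrArg (fun g : MvPolynomial (Fin n) K →ₐ[K] _ => g G) h1
  simp only [AlgHom.comp_apply, h, map_zero] at h2
  exact h2.symm

theorem integral_aux {R K : Type*} [CommRing R] [IsDomain R] [Infinite R] [Field K] [Algebra R K]
    [IsFractionRing R K] {n d : ℕ} {ι : Type*} (g : ι → MvPolynomial (Fin n) R) (hdn : d + 2 ≤ n)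
    (J : Ideal (MvPolynomial (Fin n) K))
    (hJ : J = Ideal.span (Set.range fun i => map (algebraMap R K) (g i)))
    (hd : ringKrullDim (MvPolynomial (Fin n) K ⧸ J) ≤ (d : ℕ))
    (Q : Fin n → R) (hQ : Ideal.span (Set.range fun i => eval Q (g i)) = ⊤)
    (G : MvPolynomial (Fin n) K) (hG : G ≠ 0) :
    ∃ a : Fin n → R, Ideal.span (Set.range fun i => eval a (g i)) = ⊤ ∧
      eval (fun i => algebraMap R K (a i)) G ≠ 0 := by
  have hinj : Function.Injective (algebraMap R K) := IsFractionRing.injective R K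
  have hQ1 : ∃ f ∈ J, eval (fun i => algebraMap R K (Q i)) f ≠ 0 := by
    by_contra! hcon
    have h0 : Ideal.span (Set.range fun i => eval Q (g i)) ≤ ⊥ := by
      rw [Ideal.span_le]
      rintro _ ⟨i, rfl⟩
      have := hcon (map (algebraMap R K) (g i)) (hJ ▸ Ideal.subset_span ⟨i, rfl⟩)
      rw [eval_map, ← Function.comp_def, ← MvPolynomial.eval₂_comp] at this
      exact hinj (by simpa using this)
    rw [hQ] at h0
    exact top_ne_bot (le_bot_iff.1 h0)
  obtain ⟨D, hD, hDm⟩ := generic_aux J hdn hd _ hQ1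
  set φ := aeval (R := K) (fun i => Polynomial.C (C (algebraMap R K (Q i))) +
    Polynomial.X * Polynomial.C (X i) : Fin n → Polynomial (MvPolynomial (Fin n) K)) with hφ
  have hH := mul_ne_zero hD (shift_ne_zero (fun i => algebraMap R K (Q i)) G hG)
  have hw : ∃ w : Fin n → R, eval (fun i => algebraMap R K (w i))
      (D * aeval (fun i => C (algebraMap R K (Q i)) + X i : Fin n → MvPolynomial (Fin n) K) G) ≠ 0 := by
    by_contra! hcon
    apply hH
    apply MvPolynomial.funext_set (fun _ => Set.range (algebraMap R K))
      (fun _ => Set.infinite_range_of_injective hinj)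
    intro x hx
    choose w hw using fun i => hx i trivial
    have := hcon w
    simp only [hw] at this
    rw [this, map_zero]
  obtain ⟨w, hw⟩ := hw
  rw [map_mul] at hw
  have hDw := left_ne_zero_of_mul hw
  have hGw := right_ne_zero_of_mul hw
  let θ : MvPolynomial (Fin n) R →ₐ[R] Polynomial R :=
    aeval (fun i => Polynomial.C (Q i) + Polynomial.X * Polynomial.C (w i))
  let ev : Polynomial (MvPolynomial (Fin n) K) →+* Polynomial K :=
    Polynomial.mapRingHom (eval (fun i => algebraMap R K (w i)))
  let I0 : Ideal (Polynomial R) := Ideal.span (Set.range fun i => θ (g i))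
  have hcomm : ∀ f, ev (φ (map (algebraMap R K) f)) =
      Polynomial.mapRingHom (algebraMap R K) (θ f) := by
    intro f
    have : (ev.comp φ.toRingHom).comp (map (algebraMap R K)) =
        (Polynomial.mapRingHom (algebraMap R K)).comp θ.toRingHom := by
      apply MvPolynomial.ringHom_ext
      · intro r
        simp [φ, ev, θ, Polynomial.algebraMap_apply, MvPolynomial.algebraMap_eq]
      · intro i
        simp [φ, ev, θ]
    exact congrArg (fun h : MvPolynomial (Fin n) R →+* Polynomial K => h f) this
  have hI0 : I0.map (Polynomial.mapRingHom (algebraMap R K)) = ⊤ := by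
    have h1 : (J.map φ).map ev ≤ I0.map (Polynomial.mapRingHom (algebraMap R K)) := by
      rw [Ideal.map_le_iff_le_comap, Ideal.map_le_iff_le_comap, hJ, Ideal.span_le]
      rintro _ ⟨i, rfl⟩
      change ev (φ (map (algebraMap R K) (g i))) ∈ I0.map (Polynomial.mapRingHom (algebraMap R K))
      rw [hcomm]
      exact Ideal.mem_map_of_mem _ (Ideal.subset_span ⟨i, rfl⟩)
    have h2 := h1 (Ideal.mem_map_of_mem ev hDm)
    refine Ideal.eq_top_of_isUnit_mem _ h2 ?_
    simp only [ev, Polynomial.coe_mapRingHom, Polynomial.map_C]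
    exact Polynomial.isUnit_C.2 (isUnit_iff_ne_zero.2 hDw)
  obtain ⟨r, hr, hrI⟩ := elim_aux I0 hI0
  let P : Polynomial K := aeval (fun i => Polynomial.C (algebraMap R K (Q i)) +
    Polynomial.X * Polynomial.C (algebraMap R K (w i))) G
  have hPe : ∀ v : K, P.eval v =
      eval (fun i => algebraMap R K (Q i) + v * algebraMap R K (w i)) G := by
    intro v
    have : (Polynomial.evalRingHom v).comp (aeval (fun i => Polynomial.C (algebraMap R K (Q i)) +
        Polynomial.X * Polynomial.C (algebraMap R K (w i))) :
          MvPolynomial (Fin n) K →ₐ[K] Polynomial K).toRingHom =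
        eval (fun i => algebraMap R K (Q i) + v * algebraMap R K (w i)) := by
      apply MvPolynomial.ringHom_ext
      · intro r
        simp
      · intro i
        simp
        exact mul_comm _ _
    exact congrArg (fun h : MvPolynomial (Fin n) K →+* K => h G) this
  have hP : P ≠ 0 := by
    intro h0
    apply hGw
    have h1 := hPe 1
    rw [h0, Polynomial.eval_zero] at h1
    have : (eval (fun i => algebraMap R K (w i))).comp
        (aeval (fun i => C (algebraMap R K (Q i)) + X i : Fin n → MvPolynomial (Fin n) K) :
          MvPolynomial (Fin n) K →ₐ[K] MvPolynomial (Fin n) K).toRingHom =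
        eval (fun i => algebraMap R K (Q i) + 1 * algebraMap R K (w i)) := by
      apply MvPolynomial.ringHom_ext
      · intro r
        simp
      · intro i
        simp
    exact (congrArg (fun h : MvPolynomial (Fin n) K →+* K => h G) this).trans h1.symm
  have ht : ∃ t : R, P.eval (algebraMap R K (r * t)) ≠ 0 := by
    by_contra! hcon
    apply hP
    apply Polynomial.eq_zero_of_infinite_isRoot
    refine Set.Infinite.mono ?_ (Set.infinite_range_of_injective (f := fun t : R =>
      algebraMap R K (r * t)) (fun x y hxy => mul_left_cancel₀ hr (hinj hxy)))
    rintro _ ⟨t, rfl⟩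
    exact hcon t
  obtain ⟨t, ht⟩ := ht
  refine ⟨fun i => Q i + (r * t) * w i, ?_, ?_⟩
  · set 𝔞 := Ideal.span (Set.range fun i => eval (fun i => Q i + (r * t) * w i) (g i)) with h𝔞
    have hevθ : ∀ f, (θ f).eval (r * t) = eval (fun i => Q i + (r * t) * w i) f := by
      intro f
      have : (Polynomial.evalRingHom (r * t)).comp θ.toRingHom =
          eval (fun i => Q i + (r * t) * w i) := by
        apply MvPolynomial.ringHom_ext
        · intro r
          simp [θ]
        · intro i
          simp [θ]
          exact mul_comm _ _
      exact congrArg (fun h : MvPolynomial (Fin n) R →+* R => h f) this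
    have hr𝔞 : r ∈ 𝔞 := by
      have h1 : I0 ≤ 𝔞.comap (Polynomial.evalRingHom (r * t)) := by
        rw [Ideal.span_le]
        rintro _ ⟨i, rfl⟩
        change (θ (g i)).eval (r * t) ∈ 𝔞
        rw [hevθ]
        exact Ideal.subset_span ⟨i, rfl⟩
      simpa using h1 hrI
    rw [eq_top_iff, ← hQ, Ideal.span_le]
    rintro _ ⟨i, rfl⟩
    have h1 : eval (fun i => Q i + (r * t) * w i) (g i) ∈ 𝔞 := Ideal.subset_span ⟨i, rfl⟩
    have h2 : (Ideal.Quotient.mk 𝔞).comp (eval (fun i => Q i + (r * t) * w i)) =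
        (Ideal.Quotient.mk 𝔞).comp (eval Q) := by
      apply MvPolynomial.ringHom_ext
      · intro r
        simp
      · intro i
        simp [Ideal.Quotient.eq_zero_iff_mem.2 hr𝔞]
    have h3 := congrArg (fun h : MvPolynomial (Fin n) R →+* R ⧸ 𝔞 => h (g i)) h2
    simp only [RingHom.comp_apply] at h3
    rw [Ideal.Quotient.eq_zero_iff_mem.2 h1] at h3
    exact Ideal.Quotient.eq_zero_iff_mem.1 h3.symm
  · have := hPe (algebraMap R K (r * t))
    rw [this] at ht
    simpa only [map_add, map_mul] using ht

theorem integer_finset {K : Type*} [Field K] [NumberField K] (B : Set K) (hB : B.Finite) :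
    ∃ S : Finset (HeightOneSpectrum (𝓞 K)),
      ∀ x ∈ B, x ∈ (S : Set (HeightOneSpectrum (𝓞 K))).integer K := by
  have hfin : (⋃ x ∈ B, HeightOneSpectrum.Support (𝓞 K) x).Finite :=
    hB.biUnion fun x _ => HeightOneSpectrum.Support.finite (𝓞 K) x
  refine ⟨hfin.toFinset, fun x hx v hv => ?_⟩
  by_contra hlt
  apply hv
  simp only [Set.Finite.coe_toFinset, Set.mem_iUnion]
  exact ⟨x, hx, not_le.1 hlt⟩

theorem integer_isFractionRing {K : Type*} [Field K] [NumberField K]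
    (S : Set (HeightOneSpectrum (𝓞 K))) : IsFractionRing (S.integer K) K := by
  apply IsFractionRing.of_field
  intro z
  obtain ⟨x, y, -, h⟩ := IsFractionRing.div_surjective (A := 𝓞 K) z
  exact ⟨algebraMap (𝓞 K) (S.integer K) x, algebraMap (𝓞 K) (S.integer K) y, h.symm⟩

theorem eval_mem_span {R : Type*} [CommRing R] {n : ℕ} (a : Fin n → R)
    (g : MvPolynomial (Fin n) R) (hg : constantCoeff g = 0) :
    eval a g ∈ Ideal.span (Set.range a) := by
  have h2 : (Ideal.Quotient.mk (Ideal.span (Set.range a))).comp (eval a) =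
      (Ideal.Quotient.mk (Ideal.span (Set.range a))).comp constantCoeff := by
    apply MvPolynomial.ringHom_ext
    · intro r
      simp
    · intro i
      simp only [RingHom.comp_apply, eval_X, constantCoeff_X, map_zero]
      exact Ideal.Quotient.eq_zero_iff_mem.2 (Ideal.subset_span ⟨i, rfl⟩)
  have h3 := congrArg (fun h : MvPolynomial (Fin n) R →+* _ => h g) h2
  simp only [RingHom.comp_apply, hg, map_zero] at h3
  exact Ideal.Quotient.eq_zero_iff_mem.1 h3

theorem assemble {K : Type*} [Field K] [NumberField K] {n d m : ℕ} (hdn : d + 2 ≤ n)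
    (f : Fin m → MvPolynomial (Fin n) K) (hf : ∀ i, ∃ k : ℕ, (f i).IsHomogeneous k)
    (hf0 : ∀ i, constantCoeff (f i) = 0)
    (hd : ringKrullDim (MvPolynomial (Fin n) K ⧸ Ideal.span (Set.range f)) ≤ (d : ℕ)) :
    ∃ (S : Finset (HeightOneSpectrum (𝓞 K)))
      (g : Fin m → MvPolynomial (Fin n) ((S : Set (HeightOneSpectrum (𝓞 K))).integer K)),
      (∀ i, ∃ k : ℕ, (g i).IsHomogeneous k) ∧
      (∀ i, MvPolynomial.map
              (algebraMap ((S : Set (HeightOneSpectrum (𝓞 K))).integer K) K) (g i) = f i) ∧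
      ∀ G : MvPolynomial (Fin n) K, G ≠ 0 →
        ∃ a : Fin n → ((S : Set (HeightOneSpectrum (𝓞 K))).integer K),
          Ideal.span (Set.range a) = ⊤ ∧
          Ideal.span (Set.range fun i => eval a (g i)) = ⊤ ∧
          eval (fun i => (a i : K)) G ≠ 0 := by
  have hne : ∃ i, f i ≠ 0 := by
    by_contra! hcon
    have hbot : Ideal.span (Set.range f) = ⊥ := by
      rw [Ideal.span_eq_bot]
      rintro _ ⟨i, rfl⟩
      exact hcon i
    rw [hbot, ringKrullDim_eq_of_ringEquiv (RingEquiv.quotientBot _),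
      MvPolynomial.ringKrullDim_of_isNoetherianRing, ringKrullDim_eq_zero_of_field] at hd
    simp only [Nat.card_eq_fintype_card, Fintype.card_fin, zero_add] at hd
    have : n ≤ d := by exact_mod_cast hd
    omega
  obtain ⟨i₀, hi₀⟩ := hne
  have hQ : ∃ Q : Fin n → K, eval Q (f i₀) ≠ 0 := by
    by_contra! hcon
    exact hi₀ (MvPolynomial.funext fun x => by rw [hcon x, map_zero])
  obtain ⟨Q, hQ⟩ := hQ
  obtain ⟨S, hS⟩ := integer_finset
    ((⋃ i, ((f i).coeffs : Set K)) ∪ Set.range Q ∪ {(eval Q (f i₀))⁻¹})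
    (((Set.finite_iUnion fun i => Finset.finite_toSet _).union (Set.finite_range Q)).union
      (Set.finite_singleton _))
  let R := (S : Set (HeightOneSpectrum (𝓞 K))).integer K
  have : IsFractionRing R K := integer_isFractionRing _
  have hinj : Function.Injective (algebraMap R K) := IsFractionRing.injective R K
  have hg : ∀ i, ∃ g : MvPolynomial (Fin n) R, map (algebraMap R K) g = f i := by
    intro i
    have : f i ∈ Set.range (map (σ := Fin n) (algebraMap R K)) := by
      rw [mem_range_map_iff_coeffs_subset]
      intro x hx
      exact ⟨⟨x, hS x (Or.inl (Or.inl (Set.mem_iUnion.2 ⟨i, hx⟩)))⟩, rfl⟩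
    exact this
  choose g hg using hg
  have : CharZero R := charZero_of_injective_algebraMap (R := ℤ) (by
    intro x y hxy
    have := congrArg (algebraMap R K) hxy
    simpa using this)
  have : Infinite R := inferInstance
  let Q' : Fin n → R := fun i => ⟨Q i, hS _ (Or.inl (Or.inr ⟨i, rfl⟩))⟩
  have hev : algebraMap R K (eval Q' (g i₀)) = eval Q (f i₀) := by
    rw [← hg, eval_map]
    exact (MvPolynomial.eval₂_comp (algebraMap R K) Q' (g i₀))
  have hQ' : Ideal.span (Set.range fun i => eval Q' (g i)) = ⊤ := by
    refine Ideal.eq_top_of_isUnit_mem _ (Ideal.subset_span ⟨i₀, rfl⟩) ?_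
    refine IsUnit.of_mul_eq_one ⟨(eval Q (f i₀))⁻¹, hS _ (Or.inr rfl)⟩ ?_
    apply hinj
    rw [map_mul, hev, map_one]
    exact mul_inv_cancel₀ hQ
  refine ⟨S, g, fun i => ?_, hg, fun G hG => ?_⟩
  · obtain ⟨k, hk⟩ := hf i
    exact ⟨k, MvPolynomial.IsHomogeneous.of_map hinj (by rw [hg]; exact hk)⟩
  · obtain ⟨a, ha, haG⟩ := integral_aux (K := K) g hdn (Ideal.span (Set.range f))
      (by simp only [hg]) hd Q' hQ' G hG
    refine ⟨a, ?_, ha, haG⟩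
    rw [eq_top_iff, ← ha, Ideal.span_le]
    rintro _ ⟨i, rfl⟩
    apply eval_mem_span
    apply hinj
    rw [map_zero, ← hf0 i, ← hg i, constantCoeff_map]

theorem dim_origin {K : Type*} [Field K] {n d : ℕ} :
    ringKrullDim (MvPolynomial (Fin n) K ⧸
      Ideal.span (Set.range (X : Fin n → MvPolynomial (Fin n) K))) ≤ (d : ℕ) := by
  refine (ringKrullDim_le_of_surjective ((Ideal.Quotient.mk
    (Ideal.span (Set.range (X : Fin n → MvPolynomial (Fin n) K)))).comp C) ?_).trans ?_
  · intro y
    obtain ⟨p, rfl⟩ := Ideal.Quotient.mk_surjective y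
    refine ⟨constantCoeff p, ?_⟩
    rw [RingHom.comp_apply, eq_comm, ← sub_eq_zero, ← map_sub]
    apply Ideal.Quotient.eq_zero_iff_mem.2
    have := eval_mem_span (X : Fin n → MvPolynomial (Fin n) K)
      (map C (p - C (constantCoeff p))) (by rw [constantCoeff_map]; simp)
    rw [eval_map] at this
    change eval₂Hom C X _ ∈ _ at this
    simpa using this
  · rw [ringKrullDim_eq_zero_of_field]
    exact_mod_cast Nat.zero_le d

/-- **Potential density of integral points on projective space punctured in a closed
subvariety of codimension at least 2** (the case `X = ℙ^N` of Corollary 5.2 of the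
paper).

Let `K` be a number field, `N ≥ 2`, and `Z ⊂ ℙ^N` a closed subvariety over `K` of
dimension at most `N − 2`, given by a homogeneous radical ideal `J` whose affine cone
has Krull dimension at most `N − 1`.  Then there are a finite extension `K'`, a finite
set `S` of maximal ideals of `𝓞 K'` with `R` the `S`-integers, and homogeneous
polynomials `g₁, …, g_m` with coefficients in `R` generating the homogeneous ideal of
`Z` over `K'`, such that the set of points of `ℙ^N(K')` with primitive coordinates in
`R` at which `g₁, …, g_m` generate the unit ideal of `R` is Zariski dense in `ℙ^N`. -/
theorem punctured_projective_space_integral_points_potentially_dense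
    (K : Type) [Field K] [NumberField K]
    (N : ℕ) (hN : 2 ≤ N)
    (J : Ideal (MvPolynomial (Fin (N + 1)) K))
    -- `J` is a homogeneous ideal
    (hJhom : ∃ T : Set (MvPolynomial (Fin (N + 1)) K),
      (∀ f ∈ T, ∃ n : ℕ, f.IsHomogeneous n) ∧ J = Ideal.span T)
    -- `J` is radical (it is the full ideal of the subvariety `Z`)
    (hJrad : J.IsRadical)
    -- `Z` has dimension at most `N − 2`: its affine cone has Krull dimension `≤ N − 1`
    (hJdim : ringKrullDim (MvPolynomial (Fin (N + 1)) K ⧸ J) ≤ (N - 1 : ℕ)) :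
    ∃ (K' : Type) (_ : Field K') (_ : NumberField K') (_ : Algebra K K')
      (_ : FiniteDimensional K K')
      (S : Finset (HeightOneSpectrum (𝓞 K')))
      (m : ℕ)
      (g : Fin m → MvPolynomial (Fin (N + 1)) ((S : Set (HeightOneSpectrum (𝓞 K'))).integer K')),
      -- the `gᵢ` are homogeneous
      (∀ i, ∃ n : ℕ, (g i).IsHomogeneous n) ∧
      -- the `gᵢ` generate the ideal `J·K'[x₀,…,x_N]`
      Ideal.span
          (Set.range fun i =>
            MvPolynomial.map
              (algebraMap ((S : Set (HeightOneSpectrum (𝓞 K'))).integer K') K') (g i)) =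
        J.map (MvPolynomial.map (algebraMap K K')) ∧
      -- density of the integral points of `(ℙ^N, Z)`
      ∀ G : MvPolynomial (Fin (N + 1)) K', G ≠ 0 → (∃ n : ℕ, G.IsHomogeneous n) →
        ∃ a : Fin (N + 1) → ((S : Set (HeightOneSpectrum (𝓞 K'))).integer K'),
          -- the coordinates generate the unit ideal of `R`
          Ideal.span (Set.range a) = ⊤ ∧
          -- the values of the `gᵢ` at the point generate the unit ideal of `R`
          Ideal.span (Set.range fun i => eval a (g i)) = ⊤ ∧
          -- `G` does not vanish at the point
          eval (fun i => (a i : K')) G ≠ 0 := by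
  obtain ⟨T, hT, hJT⟩ := hJhom
  have hNN : N - 1 + 2 ≤ N + 1 := by omega
  have hinj : ∀ S : Set (HeightOneSpectrum (𝓞 K)),
      Function.Injective (algebraMap (S.integer K) K) := fun S => Subtype.val_injective
  have hid : J.map (MvPolynomial.map (algebraMap K K)) = J := by
    have : MvPolynomial.map (σ := Fin (N + 1)) (algebraMap K K) = RingHom.id _ := by
      exact MvPolynomial.ringHom_ext (fun r => by simp) (fun i => by simp)
    rw [this]
    exact Ideal.map_id J
  by_cases hJ : J = ⊤
  · obtain ⟨S, g, h1, h2, h3⟩ := assemble hNN (X : Fin (N + 1) → MvPolynomial (Fin (N + 1)) K)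
      (fun i => ⟨1, isHomogeneous_X _ _⟩) (fun i => constantCoeff_X _ _) dim_origin
    refine ⟨K, inferInstance, inferInstance, inferInstance, inferInstance, S, N + 2,
      Fin.cons 1 g, ?_, ?_, ?_⟩
    · intro i
      refine Fin.cases ?_ (fun j => ?_) i
      · exact ⟨0, isHomogeneous_one _ _⟩
      · simpa using h1 j
    · rw [hid, hJ, Ideal.eq_top_iff_one]
      exact Ideal.subset_span ⟨0, by simp⟩
    · intro G hG _
      obtain ⟨a, ha1, -, ha3⟩ := h3 G hG
      refine ⟨a, ha1, ?_, ha3⟩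
      rw [Ideal.eq_top_iff_one]
      exact Ideal.subset_span ⟨0, by simp⟩
  · have hfg : (Submodule.span (MvPolynomial (Fin (N + 1)) K) T).FG := IsNoetherian.noetherian _
    obtain ⟨s, hs, hspan⟩ := (Submodule.fg_span_iff_fg_span_finset_subset T).1 hfg
    let f : Fin s.card → MvPolynomial (Fin (N + 1)) K := fun i => (s.equivFin.symm i : _)
    have hfT : ∀ i, f i ∈ T := fun i => hs (s.equivFin.symm i).2
    have hrange : Set.range f = (s : Set (MvPolynomial (Fin (N + 1)) K)) := by
      have : f = Subtype.val ∘ s.equivFin.symm := rfl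
      rw [this, s.equivFin.symm.surjective.range_comp]
      simp
    have hfJ : Ideal.span (Set.range f) = J := by
      rw [hJT, hrange]
      exact hspan.symm
    obtain ⟨S, g, h1, h2, h3⟩ := assemble hNN f (fun i => hT _ (hfT i)) (fun i => by
      by_contra hc
      apply hJ
      obtain ⟨k, hk⟩ := hT _ (hfT i)
      have hk0 : k = 0 := by
        have := hk hc
        simpa using this.symm
      subst hk0
      rw [← totalDegree_zero_iff_isHomogeneous, totalDegree_eq_zero_iff_eq_C] at hk
      refine Ideal.eq_top_of_isUnit_mem J (x := f i) ?_ ?_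
      · rw [← hfJ]
        exact Ideal.subset_span ⟨i, rfl⟩
      · rw [hk]
        exact (isUnit_iff_ne_zero.2 hc).map C) (by rw [hfJ]; exact hJdim)
    refine ⟨K, inferInstance, inferInstance, inferInstance, inferInstance, S, s.card,
      g, h1, ?_, ?_⟩
    · rw [hid, ← hfJ]
      simp only [h2]
    · intro G hG _
      exact h3 G hG
end
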